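/- There exists a Legendre pair (A, B) of length 147 such that moreover the sets I_A = {i ∈ ℤ_147 : a_i = 1} and I_B = {i ∈ ℤ_147 : b_i = 1} are each invariant under multiplication by 67 modulo 147 (so that the multiplier group of each sequence contains the order-3 subgroup {1, 67, 79} of ℤ_147*). -/

import Mathlib

/-- The periodic autocorrelation function of a sequence indexed by `ℤ_ℓ`:
`PAF(A,s) = ∑_{i} a_i a_{i+s}`. -/
def paf (ℓ : ℕ) [NeZero ℓ] (a : ZMod ℓ → ℤ) (s : ZMod ℓ) : ℤ :=
  ∑ i : ZMod ℓ, a i * a (i + s)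

/-- Two `±1` sequences indexed by `ℤ_ℓ` with entry sums equal to 1 form a Legendre pair
if `PAF(A,s) + PAF(B,s) = -2` for all `s = 1, …, (ℓ-1)/2`. -/
def IsLegendrePair (ℓ : ℕ) [NeZero ℓ] (a b : ZMod ℓ → ℤ) : Prop :=
  (∀ i, a i = 1 ∨ a i = -1) ∧
  (∀ i, b i = 1 ∨ b i = -1) ∧
  (∑ i : ZMod ℓ, a i = 1) ∧
  (∑ i : ZMod ℓ, b i = 1) ∧
  (∀ s : ℕ, 1 ≤ s → s ≤ (ℓ - 1) / 2 → paf ℓ a (s : ZMod ℓ) + paf ℓ b (s : ZMod ℓ) = -2)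

/-- The `±1` sequence indexed by `ℤ_ℓ` whose `+1` entries are the positions of the binary
digits `1` of `N`. -/
def signSeq (ℓ N : ℕ) (i : ZMod ℓ) : ℤ :=
  if N.testBit i.val then 1 else -1

theorem signSeq_eq_or (ℓ N : ℕ) (i : ZMod ℓ) : signSeq ℓ N i = 1 ∨ signSeq ℓ N i = -1 :=
  ite_eq_or_eq _ _ _

theorem sum_zmod_eq_sum_range {M : Type*} [AddCommMonoid M] (ℓ : ℕ) [NeZero ℓ] (f : ℕ → M) :
    ∑ i : ZMod ℓ, f i.val = ∑ k ∈ Finset.range ℓ, f k :=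
  Finset.sum_bij' (fun i _ => i.val) (fun k _ => (k : ZMod ℓ))
    (fun i _ => Finset.mem_range.2 i.val_lt) (fun _ _ => Finset.mem_univ _)
    (fun i _ => ZMod.natCast_zmod_val i)
    (fun _ hk => ZMod.val_cast_of_lt (Finset.mem_range.1 hk)) (fun _ _ => rfl)

/-- The autocorrelation of a `±1` sequence counts the positions where the sequence and its
shift differ. -/
theorem paf_signSeq (ℓ N s : ℕ) [NeZero ℓ] :
    paf ℓ (signSeq ℓ N) s =
      ℓ - 2 * (Nat.count (fun k => N.testBit k ≠ N.testBit ((k + s) % ℓ)) ℓ : ℤ) := by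
  have h (i : ZMod ℓ) : signSeq ℓ N i * signSeq ℓ N (i + s) =
      1 - 2 * if N.testBit i.val ≠ N.testBit ((i.val + s) % ℓ) then 1 else 0 := by
    have hv : (i + s).val = (i.val + s) % ℓ := by
      rw [ZMod.val_add, ZMod.val_natCast, Nat.add_mod_mod]
    unfold signSeq
    rw [hv]
    cases N.testBit i.val <;> cases N.testBit ((i.val + s) % ℓ) <;> rfl
  simp only [paf, h]
  rw [sum_zmod_eq_sum_range ℓ (fun k : ℕ =>
      1 - 2 * if N.testBit k ≠ N.testBit ((k + s) % ℓ) then (1 : ℤ) else 0),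
    Finset.sum_sub_distrib, ← Finset.mul_sum, Finset.sum_boole, Nat.count_eq_card_filter_range]
  simp

/-- A level set of a function invariant under multiplication by a unit is invariant as well. -/
theorem image_mul_eq {R α : Type*} [CommMonoid R] (u v : R) (huv : u * v = 1) (f : R → α)
    (hf : ∀ i, f (u * i) = f i) {c : α} :
    (fun i => u * i) '' {i | f i = c} = {i | f i = c} := by
  ext i
  constructor
  · rintro ⟨j, hj, rfl⟩
    exact (hf j).trans hj
  · intro hi
    have hvi : u * (v * i) = i := by rw [← mul_assoc, huv, one_mul]
    exact ⟨v * i, (hf _).symm.trans ((congrArg f hvi).trans hi), hvi⟩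

/-- The positions of the `+1` entries of the first sequence, as binary digits. -/
def positionsA : ℕ := 154880190543576775819688735280928871544122884

/-- The positions of the `+1` entries of the second sequence, as binary digits. -/
def positionsB : ℕ := 119005437625255010665794704925978466290079298

/-- There exists a Legendre pair `(A,B)` of length 147 such that the sets
`I_A = {i : a_i = 1}` and `I_B = {i : b_i = 1}` are each invariant under multiplication
by 67 modulo 147 (so the multiplier group of each sequence contains the order-3
subgroup {1, 67, 79} of `ℤ_147*`). -/
theorem legendre_pair_147_exists :
    ∃ a b : ZMod 147 → ℤ, IsLegendrePair 147 a b ∧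
      (fun i => (67 : ZMod 147) * i) '' {i | a i = 1} = {i | a i = 1} ∧
      (fun i => (67 : ZMod 147) * i) '' {i | b i = 1} = {i | b i = 1} := by
  refine ⟨signSeq 147 positionsA, signSeq 147 positionsB,
    ⟨signSeq_eq_or _ _, signSeq_eq_or _ _, by decide +kernel, by decide +kernel, ?_⟩,
    image_mul_eq (67 : ZMod 147) 79 (by decide) _ (by decide +kernel),
    image_mul_eq (67 : ZMod 147) 79 (by decide) _ (by decide +kernel)⟩
  have h : ∀ s : ℕ, s < 74 → 1 ≤ s →
      Nat.count (fun k => positionsA.testBit k ≠ positionsA.testBit ((k + s) % 147)) 147 +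
      Nat.count (fun k => positionsB.testBit k ≠ positionsB.testBit ((k + s) % 147)) 147 =
        148 := by
    decide +kernel
  intro s hs hs'
  have hd := h s (by omega) hs
  rw [paf_signSeq, paf_signSeq]
  omega
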